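/- arXiv:2407.12335 — 3 statements merged into one kernel-verified Lean document; each statement's English description precedes it below -/
import Mathlib

section
/- Let V be a complex vector space and let (e_n)_{n≥1}, (f_n)_{n≥1} be linear endomorphisms of V satisfying e_m ∘ e_n = e_n ∘ e_m = e_{min(m,n)} and f_m ∘ f_n = f_n ∘ f_m = f_{min(m,n)} for all m,n ≥ 1, and e_m ∘ f_n = f_n ∘ e_m for all m,n ≥ 1. With the definitions of E^{(0)}_k, E^{(1)}_k and D^{(0)}_k, D^{(1)}_k below, the following hold: (1) E^{(0)}_m ∘ E^{(1)}_n = E^{(1)}_n ∘ E^{(0)}_m for all m,n ≥ 1; (2) E^{(1)}_n ∘ E^{(0)}_n = E^{(0)}_n and E^{(0)}_{n+2} ∘ E^{(1)}_n = E^{(1)}_n for all n ≥ 1; (3) D^{(0)}_{2m} ∘ D^{(1)}_{2n−1} = D^{(1)}_{2n−1} ∘ D^{(0)}_{2m} = 0 for all m,n ≥ 1. -/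
noncomputable section

/-- `E^{(0)}_k`: for `k = 2n-1`, `e_n ∘ f_n`; for `k = 2n`, `e_{n+1} ∘ f_n`; and `E^{(0)}_0 = 0`. -/
noncomputable def E0 {V : Type*} [AddCommGroup V] [Module ℂ V]
    (e f : ℕ → Module.End ℂ V) : ℕ → Module.End ℂ V := fun k =>
  if k = 0 then 0
  else if k % 2 = 1 then e ((k + 1) / 2) * f ((k + 1) / 2)
  else e (k / 2 + 1) * f (k / 2)

/-- `E^{(1)}_k`: for `k = 2n-1`, `e_n ∘ f_{n+1}`; for `k = 2n`, `e_{n+1} ∘ f_{n+1}`;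
and `E^{(1)}_0 = 0`. -/
noncomputable def E1 {V : Type*} [AddCommGroup V] [Module ℂ V]
    (e f : ℕ → Module.End ℂ V) : ℕ → Module.End ℂ V := fun k =>
  if k = 0 then 0
  else if k % 2 = 1 then e ((k + 1) / 2) * f ((k + 1) / 2 + 1)
  else e (k / 2 + 1) * f (k / 2 + 1)

/-- The difference operators `D_k := E_k - E_{k-1}` for `k ≥ 1`. -/
noncomputable def Dop {V : Type*} [AddCommGroup V] [Module ℂ V]
    (E : ℕ → Module.End ℂ V) : ℕ → Module.End ℂ V := fun k => E k - E (k - 1)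

/-- For index pairs `a, c ≥ 1` and `b, d ≥ 1`, the products `e_a f_b` multiply by taking minima. -/
theorem mul_mul_mul_eq_min {R : Type*} [Semigroup R] {e f : ℕ → R}
    (he : ∀ m n, 1 ≤ m → 1 ≤ n → e m * e n = e (min m n))
    (hf : ∀ m n, 1 ≤ m → 1 ≤ n → f m * f n = f (min m n))
    (hef : ∀ m n, 1 ≤ m → 1 ≤ n → e m * f n = f n * e m)
    {a b c d : ℕ} (ha : 1 ≤ a) (hb : 1 ≤ b) (hc : 1 ≤ c) (hd : 1 ≤ d) :
    e a * f b * (e c * f d) = e (min a c) * f (min b d) := by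
  rw [← he a c ha hc, ← hf b d hb hd, mul_assoc, ← mul_assoc (f b), ← hef c b hc hb]
  simp only [mul_assoc]

section

variable {V : Type*} [AddCommGroup V] [Module ℂ V] (e f : ℕ → Module.End ℂ V)

theorem E0_eq {k : ℕ} (hk : 1 ≤ k) : E0 e f k = e (k / 2 + 1) * f ((k + 1) / 2) := by
  unfold E0
  split_ifs with h0 h1
  · omega
  · rw [show (k + 1) / 2 = k / 2 + 1 by omega]
  · rw [show (k + 1) / 2 = k / 2 by omega]

theorem E1_eq {k : ℕ} (hk : 1 ≤ k) : E1 e f k = e (k / 2 + 1) * f ((k + 1) / 2 + 1) := by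
  unfold E1
  split_ifs with h0 h1
  · omega
  · rw [show (k + 1) / 2 = k / 2 + 1 by omega]
  · rw [show (k + 1) / 2 = k / 2 by omega]

theorem Dop_E0_two_mul {m : ℕ} (hm : 1 ≤ m) :
    Dop (E0 e f) (2 * m) = e (m + 1) * f m - e m * f m := by
  rw [Dop, E0_eq e f (by omega), E0_eq e f (by omega), show 2 * m / 2 = m by omega,
    show (2 * m + 1) / 2 = m by omega, show (2 * m - 1) / 2 + 1 = m by omega,
    show (2 * m - 1 + 1) / 2 = m by omega]

theorem Dop_E1_one : Dop (E1 e f) 1 = e 1 * f 2 := by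
  simp [Dop, E1]

theorem Dop_E1_two_mul_sub_one {n : ℕ} (hn : 2 ≤ n) :
    Dop (E1 e f) (2 * n - 1) = e n * f (n + 1) - e n * f n := by
  rw [Dop, E1_eq e f (by omega), E1_eq e f (by omega), show (2 * n - 1) / 2 + 1 = n by omega,
    show (2 * n - 1 + 1) / 2 = n by omega, show (2 * n - 1 - 1) / 2 + 1 = n by omega,
    show (2 * n - 1 - 1 + 1) / 2 + 1 = n by omega]

end

/-- for commuting families `(e_n)_{n≥1}`, `(f_n)_{n≥1}` of linear endomorphisms
of a complex vector space `V` with `e_m e_n = e_n e_m = e_{min(m,n)}`,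
`f_m f_n = f_n f_m = f_{min(m,n)}` and `e_m f_n = f_n e_m`, one has:
(1) `E^{(0)}_m` and `E^{(1)}_n` commute;
(2) `E^{(1)}_n ∘ E^{(0)}_n = E^{(0)}_n` and `E^{(0)}_{n+2} ∘ E^{(1)}_n = E^{(1)}_n`;
(3) `D^{(0)}_{2m} ∘ D^{(1)}_{2n-1} = D^{(1)}_{2n-1} ∘ D^{(0)}_{2m} = 0`. -/
theorem stmt7 {V : Type*} [AddCommGroup V] [Module ℂ V]
    (e f : ℕ → Module.End ℂ V)
    (he : ∀ m n, 1 ≤ m → 1 ≤ n → e m * e n = e (min m n))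
    (hf : ∀ m n, 1 ≤ m → 1 ≤ n → f m * f n = f (min m n))
    (hef : ∀ m n, 1 ≤ m → 1 ≤ n → e m * f n = f n * e m) :
    (∀ m n, 1 ≤ m → 1 ≤ n → E0 e f m * E1 e f n = E1 e f n * E0 e f m) ∧
    (∀ n, 1 ≤ n → E1 e f n * E0 e f n = E0 e f n ∧ E0 e f (n + 2) * E1 e f n = E1 e f n) ∧
    (∀ m n, 1 ≤ m → 1 ≤ n →
      Dop (E0 e f) (2 * m) * Dop (E1 e f) (2 * n - 1) = 0 ∧
      Dop (E1 e f) (2 * n - 1) * Dop (E0 e f) (2 * m) = 0) := by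
  have key {a b c d : ℕ} (ha : 1 ≤ a) (hb : 1 ≤ b) (hc : 1 ≤ c) (hd : 1 ≤ d) :=
    mul_mul_mul_eq_min he hf hef ha hb hc hd
  have comm (m n : ℕ) (hm : 1 ≤ m) (hn : 1 ≤ n) :
      E0 e f m * E1 e f n = E1 e f n * E0 e f m := by
    rw [E0_eq e f hm, E1_eq e f hn, key (by omega) (by omega) (by omega) (by omega),
      key (by omega) (by omega) (by omega) (by omega), min_comm, min_comm ((m + 1) / 2)]
  refine ⟨comm, fun n hn => ⟨?_, ?_⟩, fun m n hm hn => ?_⟩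
  · rw [E0_eq e f hn, E1_eq e f hn, key (by omega) (by omega) (by omega) (by omega),
      min_self, min_eq_right (by omega)]
  · rw [E0_eq e f (by omega), E1_eq e f hn, key (by omega) (by omega) (by omega) (by omega),
      min_eq_right (by omega), min_eq_right (by omega)]
  · rw [Dop_E0_two_mul e f hm]
    obtain rfl | hn2 : n = 1 ∨ 2 ≤ n := by omega
    · rw [show 2 * 1 - 1 = 1 from rfl, Dop_E1_one, sub_mul, mul_sub]
      repeat rw [key (by omega) (by omega) (by omega) (by omega)]
      simp [hm]
    · rw [Dop_E1_two_mul_sub_one e f hn2]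
      simp only [sub_mul, mul_sub]
      repeat rw [key (by omega) (by omega) (by omega) (by omega)]
      rcases le_or_gt n m with h | h
      · simp [h, h.trans m.le_succ]
      · simp [h.le, h.le.trans n.le_succ]

end
end

section
/- Let V be a complex vector space and let (e_n)_{n≥1}, (f_n)_{n≥1} be linear endomorphisms of V satisfying e_m ∘ e_n = e_n ∘ e_m = e_{min(m,n)} and f_m ∘ f_n = f_n ∘ f_m = f_{min(m,n)} for all m,n ≥ 1, and e_m ∘ f_n = f_n ∘ e_m for all m,n ≥ 1. With the definitions of D^{(0)}_k, D^{(1)}_k and T_n below, one has for all m,n ≥ 1: D^{(0)}_{2m−1} ∘ D^{(1)}_{2n} = D^{(1)}_{2n} ∘ D^{(0)}_{2m−1} = 0 whenever m ≠ n+1, and D^{(0)}_{2(n+1)−1} ∘ D^{(1)}_{2n} = D^{(1)}_{2n} ∘ D^{(0)}_{2(n+1)−1} = T_n. -/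
noncomputable section

/-- `T_n := (e_{n+1} - e_n) ∘ (f_{n+1} - f_n)`. -/
noncomputable def Tn {V : Type*} [AddCommGroup V] [Module ℂ V]
    (e f : ℕ → Module.End ℂ V) : ℕ → Module.End ℂ V := fun n =>
  (e (n + 1) - e n) * (f (n + 1) - f n)

section

variable {V : Type*} [AddCommGroup V] [Module ℂ V]

theorem Dop_E0_odd (e f : ℕ → Module.End ℂ V) {m : ℕ} (hm : 1 ≤ m) :
    Dop (E0 e f) (2 * m - 1) = e m * (f m - if m = 1 then 0 else f (m - 1)) := by
  obtain ⟨k, rfl⟩ : ∃ k, m = k + 1 := ⟨m - 1, by omega⟩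
  have h1 : (2 * (k + 1) - 1) % 2 = 1 := by omega
  have h2 : (2 * (k + 1) - 1 + 1) / 2 = k + 1 := by omega
  have h3 : 2 * (k + 1) - 1 ≠ 0 := by omega
  have h4 : 2 * (k + 1) - 1 - 1 = 2 * k := by omega
  rw [Dop, h4]
  by_cases hk : k = 0
  · subst hk
    simp [E0]
  · simp [E0, h1, h2, h3, hk, mul_sub]

theorem Dop_E1_even (e f : ℕ → Module.End ℂ V) {n : ℕ} (hn : 1 ≤ n) :
    Dop (E1 e f) (2 * n) = (e (n + 1) - e n) * f (n + 1) := by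
  have h1 : (2 * n - 1) % 2 = 1 := by omega
  have h2 : (2 * n - 1 + 1) / 2 = n := by omega
  have h3 : 2 * n - 1 ≠ 0 := by omega
  have h4 : n ≠ 0 := by omega
  simp [Dop, E1, h1, h2, h3, h4, sub_mul]

theorem commute_of_mul_eq_min {g : ℕ → Module.End ℂ V}
    (hg : ∀ m n, 1 ≤ m → 1 ≤ n → g m * g n = g (min m n)) {m n : ℕ} (hm : 1 ≤ m) (hn : 1 ≤ n) :
    Commute (g m) (g n) := by
  rw [Commute, SemiconjBy, hg m n hm hn, hg n m hn hm, min_comm]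

theorem mul_succ_sub_eq_zero {g : ℕ → Module.End ℂ V}
    (hg : ∀ m n, 1 ≤ m → 1 ≤ n → g m * g n = g (min m n)) {m n : ℕ} (hm : 1 ≤ m) (hn : 1 ≤ n)
    (hmn : m ≤ n) : g m * (g (n + 1) - g n) = 0 := by
  rw [mul_sub, hg m (n + 1) hm (by omega), hg m n hm hn, min_eq_left hmn,
    min_eq_left (by omega), sub_self]

theorem Dop_E0_mul_Dop_E1 {e f : ℕ → Module.End ℂ V}
    (hef : ∀ m n, 1 ≤ m → 1 ≤ n → e m * f n = f n * e m) {m n : ℕ} (hm : 1 ≤ m) (hn : 1 ≤ n) :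
    Dop (E0 e f) (2 * m - 1) * Dop (E1 e f) (2 * n) =
      (e m * (e (n + 1) - e n)) * ((f m - if m = 1 then 0 else f (m - 1)) * f (n + 1)) := by
  have h : Commute (f m - if m = 1 then 0 else f (m - 1)) (e (n + 1) - e n) := by
    have hfe : ∀ a b, 1 ≤ a → 1 ≤ b → Commute (f a) (e b) := fun a b ha hb =>
      (hef b a hb ha).symm
    refine Commute.sub_left ((hfe _ _ hm (by omega)).sub_right (hfe _ _ hm hn)) ?_
    split_ifs with h1
    · exact Commute.zero_left _
    · exact (hfe _ _ (by omega) (by omega)).sub_right (hfe _ _ (by omega) hn)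
  rw [Dop_E0_odd e f hm, Dop_E1_even e f hn, h.mul_mul_mul_comm]

theorem commute_Dop_E0_Dop_E1 {e f : ℕ → Module.End ℂ V}
    (he : ∀ m n, 1 ≤ m → 1 ≤ n → e m * e n = e (min m n))
    (hf : ∀ m n, 1 ≤ m → 1 ≤ n → f m * f n = f (min m n))
    (hef : ∀ m n, 1 ≤ m → 1 ≤ n → e m * f n = f n * e m) {m n : ℕ} (hm : 1 ≤ m) (hn : 1 ≤ n) :
    Commute (Dop (E0 e f) (2 * m - 1)) (Dop (E1 e f) (2 * n)) := by
  have hn' : 1 ≤ n + 1 := by omega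
  have key : ∀ a, 1 ≤ a → Commute (f a) ((e (n + 1) - e n) * f (n + 1)) := fun a ha =>
    (Commute.sub_right (hef _ _ hn' ha).symm (hef _ _ hn ha).symm).mul_right
      (commute_of_mul_eq_min hf ha hn')
  rw [Dop_E0_odd e f hm, Dop_E1_even e f hn]
  refine Commute.mul_left ?_ (Commute.sub_left (key m hm) ?_)
  · exact ((commute_of_mul_eq_min he hm hn').sub_right (commute_of_mul_eq_min he hm hn)).mul_right
      (hef _ _ hm hn')
  · split_ifs with h1
    · exact Commute.zero_left _
    · exact key _ (by omega)

end

/-- for commuting families `(e_n)_{n≥1}`, `(f_n)_{n≥1}` of linear endomorphisms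
of a complex vector space `V` with `e_m e_n = e_n e_m = e_{min(m,n)}`,
`f_m f_n = f_n f_m = f_{min(m,n)}` and `e_m f_n = f_n e_m`, one has for all `m,n ≥ 1`:
`D^{(0)}_{2m-1} ∘ D^{(1)}_{2n} = D^{(1)}_{2n} ∘ D^{(0)}_{2m-1} = 0` whenever `m ≠ n+1`, and
`D^{(0)}_{2(n+1)-1} ∘ D^{(1)}_{2n} = D^{(1)}_{2n} ∘ D^{(0)}_{2(n+1)-1} = T_n`. -/
theorem stmt8 {V : Type*} [AddCommGroup V] [Module ℂ V]
    (e f : ℕ → Module.End ℂ V)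
    (he : ∀ m n, 1 ≤ m → 1 ≤ n → e m * e n = e (min m n))
    (hf : ∀ m n, 1 ≤ m → 1 ≤ n → f m * f n = f (min m n))
    (hef : ∀ m n, 1 ≤ m → 1 ≤ n → e m * f n = f n * e m) :
    (∀ m n, 1 ≤ m → 1 ≤ n → m ≠ n + 1 →
      Dop (E0 e f) (2 * m - 1) * Dop (E1 e f) (2 * n) = 0 ∧
      Dop (E1 e f) (2 * n) * Dop (E0 e f) (2 * m - 1) = 0) ∧
    (∀ n, 1 ≤ n →
      Dop (E0 e f) (2 * (n + 1) - 1) * Dop (E1 e f) (2 * n) = Tn e f n ∧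
      Dop (E1 e f) (2 * n) * Dop (E0 e f) (2 * (n + 1) - 1) = Tn e f n) := by
  refine ⟨fun m n hm hn hmn => ?_, fun n hn => ?_⟩
  · rw [← (commute_Dop_E0_Dop_E1 he hf hef hm hn).eq, and_self, Dop_E0_mul_Dop_E1 hef hm hn]
    rcases Nat.lt_or_ge n m with h | h
    · have h1 : m ≠ 1 := by omega
      rw [if_neg h1, sub_mul, hf m (n + 1) hm (by omega), hf (m - 1) (n + 1) (by omega) (by omega),
        min_eq_right (by omega), min_eq_right (by omega), sub_self, mul_zero]
    · rw [mul_succ_sub_eq_zero he hm hn h, zero_mul]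
  · have hn' : 1 ≤ n + 1 := by omega
    have h1 : n + 1 ≠ 1 := by omega
    rw [← (commute_Dop_E0_Dop_E1 he hf hef hn' hn).eq, and_self, Dop_E0_mul_Dop_E1 hef hn' hn,
      if_neg h1, Nat.add_sub_cancel, mul_sub, sub_mul (f (n + 1)), he _ _ hn' hn', he _ _ hn' hn,
      hf _ _ hn' hn', hf _ _ hn hn', min_self, min_eq_right (Nat.le_succ n),
      min_eq_left (Nat.le_succ n), Tn]

end
end

section
/- Let X be a Banach space and let (E_n)_{n≥1} be a sequence of bounded linear operators on X satisfying E_m ∘ E_n = E_n ∘ E_m = E_{min(m,n)} for all m,n ≥ 1 and such that E_n x → x in norm for every x ∈ X. Set E₀ := 0, let D_n := E_n − E_{n−1} for n ≥ 1, let D := ⋃_{n≥1} range(E_n), and for a set I of positive integers define P : D → D by P(x) := Σ_{i∈I} D_i(x) (a finite sum, since D_i(x) = 0 for i larger than any n with E_n x = x). Then the norm closure of P(D) in X equals {x ∈ X : D_i(x) = 0 for every positive integer i ∉ I}. -/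
open Filter

noncomputable section

/-- The differences `E i - E (i - 1)` of a commuting family with `E m ∘ E n = E (min m n)`
vanish on the range of `E n` beyond `n`, and ignore `E n` up to `n`. -/
theorem sub_pred_apply_apply {X : Type*} [NormedAddCommGroup X] [NormedSpace ℝ X]
    {E : ℕ → X →L[ℝ] X} (hE : ∀ m n x, E m (E n x) = E (min m n) x) (i n : ℕ) (x : X) :
    (E i - E (i - 1)) (E n x) = if i ≤ n then (E i - E (i - 1)) x else 0 := by
  simp only [sub_apply, hE]
  split_ifs with h
  · rw [min_eq_left h, min_eq_left (by omega)]
  · rw [min_eq_right (by omega), min_eq_right (by omega), sub_self]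

theorem sub_pred_apply_sub_pred {X : Type*} [NormedAddCommGroup X] [NormedSpace ℝ X]
    {E : ℕ → X →L[ℝ] X} (hE : ∀ m n x, E m (E n x) = E (min m n) x) {i j : ℕ} (hij : i ≠ j)
    (x : X) : (E i - E (i - 1)) ((E j - E (j - 1)) x) = 0 := by
  rw [sub_apply (E j), map_sub, sub_pred_apply_apply hE,
    sub_pred_apply_apply hE]
  rcases lt_or_gt_of_ne hij with h | h
  · rw [if_pos h.le, if_pos (by omega), sub_self]
  · rw [if_neg (by omega), if_neg (by omega), sub_self]

theorem sum_range_sub_pred {X : Type*} [NormedAddCommGroup X] [NormedSpace ℝ X]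
    {E : ℕ → X →L[ℝ] X} (hE0 : E 0 = 0) (n : ℕ) (x : X) :
    ∑ i ∈ Finset.range (n + 1), (E i - E (i - 1)) x = E n x := by
  induction n with
  | zero => simp [hE0]
  | succ n ih => rw [Finset.sum_range_succ, ih]; simp

theorem tsum_indicator_sub_pred {X : Type*} [NormedAddCommGroup X] [NormedSpace ℝ X]
    {E : ℕ → X →L[ℝ] X} (hE : ∀ m n x, E m (E n x) = E (min m n) x) (I : Set ℕ) (n : ℕ) (x : X) :
    ∑' i : ℕ, I.indicator (fun i => (E i - E (i - 1)) (E n x)) i =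
      ∑ i ∈ Finset.range (n + 1), I.indicator (fun i => (E i - E (i - 1)) x) i := by
  classical
  rw [tsum_eq_sum (s := Finset.range (n + 1))]
  · refine Finset.sum_congr rfl fun i hi => ?_
    rw [Finset.mem_range] at hi
    simp only [Set.indicator_apply, sub_pred_apply_apply hE, if_pos (Nat.le_of_lt_succ hi)]
  · intro i hi
    rw [Finset.mem_range] at hi
    simp only [Set.indicator_apply, sub_pred_apply_apply hE, if_neg (show ¬ i ≤ n by omega),
      ite_self]

/-- let `X` be a Banach space and `(E_n)_{n≥1}` bounded operators on `X` with
`E_m ∘ E_n = E_n ∘ E_m = E_{min(m,n)}` and `E_n x → x` for every `x`. With `E₀ := 0`,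
`D_n := E_n - E_{n-1}`, `D := ⋃_{n≥1} range (E_n)` and, for a set `I` of positive integers,
`P x := Σ_{i ∈ I} D_i x` (a finite sum on `D`, realized as a `tsum` with indicator), the norm
closure of `P(D)` in `X` equals `{x ∈ X : D_i x = 0 for every positive integer i ∉ I}`. -/
theorem stmt10 {X : Type*} [NormedAddCommGroup X] [NormedSpace ℝ X] [CompleteSpace X]
    (E : ℕ → X →L[ℝ] X) (hE0 : E 0 = 0)
    (hcomp : ∀ m n, 1 ≤ m → 1 ≤ n → (E m).comp (E n) = E (min m n))
    (hlim : ∀ x : X, Tendsto (fun n => E n x) atTop (nhds x))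
    (I : Set ℕ) (hI : ∀ i ∈ I, 1 ≤ i) :
    closure {y : X | ∃ x : X, (∃ n, 1 ≤ n ∧ x ∈ Set.range (E n)) ∧
        y = ∑' i : ℕ, I.indicator (fun i => (E i - E (i - 1)) x) i} =
      {x : X | ∀ i, 1 ≤ i → i ∉ I → (E i - E (i - 1)) x = 0} := by
  classical
  have hE : ∀ m n x, E m (E n x) = E (min m n) x := by
    intro m n x
    rcases Nat.eq_zero_or_pos m with rfl | hm
    · simp [hE0]
    rcases Nat.eq_zero_or_pos n with rfl | hn
    · simp [hE0]
    rw [← hcomp m n hm hn, ContinuousLinearMap.comp_apply]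
  apply Set.Subset.antisymm
  · refine closure_minimal ?_ ?_
    · rintro _ ⟨_, ⟨n, -, x, rfl⟩, rfl⟩ j - hjI
      rw [tsum_indicator_sub_pred hE, map_sum]
      refine Finset.sum_eq_zero fun i _ => ?_
      rw [Set.indicator_apply]
      split_ifs with hiI
      · exact sub_pred_apply_sub_pred hE (ne_of_mem_of_not_mem hiI hjI).symm x
      · exact map_zero _
    · simp only [Set.ofPred_forall]
      exact isClosed_iInter fun i => isClosed_iInter fun _ => isClosed_iInter fun _ =>
        isClosed_eq (E i - E (i - 1)).continuous continuous_const
  · intro x hx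
    refine mem_closure_of_tendsto (hlim x) ((eventually_ge_atTop 1).mono fun n hn => ?_)
    refine ⟨E n x, ⟨n, hn, x, rfl⟩, ?_⟩
    rw [tsum_indicator_sub_pred hE, ← sum_range_sub_pred hE0]
    refine Finset.sum_congr rfl fun i _ => ?_
    rw [Set.indicator_apply]
    split_ifs with hiI
    · rfl
    · rcases Nat.eq_zero_or_pos i with rfl | hi
      · simp
      · exact hx i hi hiI

end
end
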